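/- arXiv:1809.00167 — 2 statements merged into one kernel-verified Lean document; each statement's English description precedes it below -/
import Mathlib

section
/- The relation R_○ on MCS_χ is serial: for each Γ̄ ∈ MCS_χ there exists Δ̄ ∈ MCS_χ with Γ̄ R_○ Δ̄. -/
namespace TJL

/-- Justification terms: constants, variables, !t, t+t, t·t. -/
inductive JTerm : Type
  | const : ℕ → JTerm
  | var : ℕ → JTerm
  | bang : JTerm → JTerm
  | plus : JTerm → JTerm → JTerm
  | app : JTerm → JTerm → JTerm

/-- Formulas of LPLTL^P with `h` agents. -/
inductive Formula (h : ℕ) : Type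
  | atom : ℕ → Formula h
  | bot : Formula h
  | imp : Formula h → Formula h → Formula h
  | next : Formula h → Formula h
  | wprev : Formula h → Formula h
  | funtil : Formula h → Formula h → Formula h
  | fsince : Formula h → Formula h → Formula h
  | jbox : JTerm → Fin h → Formula h → Formula h

namespace Formula

variable {h : ℕ}

def neg (φ : Formula h) : Formula h := φ.imp .bot
def top : Formula h := neg .bot
def sprev (φ : Formula h) : Formula h := neg (wprev (neg φ))
def ev (φ : Formula h) : Formula h := funtil top φ
def always (φ : Formula h) : Formula h := neg (ev (neg φ))
def once (φ : Formula h) : Formula h := fsince top φ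
def halways (φ : Formula h) : Formula h := neg (once (neg φ))
def or' (φ ψ : Formula h) : Formula h := (neg φ).imp ψ
def and' (φ ψ : Formula h) : Formula h := neg (or' (neg φ) (neg ψ))
def iff' (φ ψ : Formula h) : Formula h := and' (φ.imp ψ) (ψ.imp φ)

end Formula

open Formula

/-- A boolean valuation respecting ⊥ and →. -/
def IsPropEval {h : ℕ} (v : Formula h → Bool) : Prop :=
  v .bot = false ∧ ∀ φ ψ : Formula h, v (φ.imp ψ) = (!(v φ) || v ψ)

/-- Propositional tautologies. -/
def Tautology {h : ℕ} (φ : Formula h) : Prop :=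
  ∀ v : Formula h → Bool, IsPropEval v → v φ = true

/-- The axioms of LPLTL^P. -/
inductive Ax {h : ℕ} : Formula h → Prop
  | taut (φ : Formula h) : Tautology φ → Ax φ
  | nextK (φ ψ : Formula h) : Ax ((Formula.next (φ.imp ψ)).imp ((Formula.next φ).imp (Formula.next ψ)))
  | boxK (φ ψ : Formula h) : Ax ((always (φ.imp ψ)).imp ((always φ).imp (always ψ)))
  | func (φ : Formula h) : Ax (iff' (Formula.next (neg φ)) (neg (Formula.next φ)))
  | ind (φ : Formula h) : Ax ((always (φ.imp (Formula.next φ))).imp (φ.imp (always φ)))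
  | until1 (φ ψ : Formula h) : Ax ((Formula.funtil φ ψ).imp (ev ψ))
  | until2 (φ ψ : Formula h) :
      Ax (iff' (Formula.funtil φ ψ) (or' ψ (and' φ (Formula.next (Formula.funtil φ ψ)))))
  | hboxK (φ ψ : Formula h) : Ax ((halways (φ.imp ψ)).imp ((halways φ).imp (halways ψ)))
  | wprevK (φ ψ : Formula h) :
      Ax ((Formula.wprev (φ.imp ψ)).imp ((Formula.wprev φ).imp (Formula.wprev ψ)))
  | sw (φ : Formula h) : Ax ((sprev φ).imp (Formula.wprev φ))
  | fp (φ : Formula h) : Ax (φ.imp (Formula.next (sprev φ)))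
  | pf (φ : Formula h) : Ax (φ.imp (Formula.wprev (Formula.next φ)))
  | initial : Ax (once (Formula.wprev (.bot : Formula h)))
  | hind (φ : Formula h) : Ax ((halways (φ.imp (Formula.wprev φ))).imp (φ.imp (halways φ)))
  | since1 (φ ψ : Formula h) : Ax ((Formula.fsince φ ψ).imp (once ψ))
  | since2 (φ ψ : Formula h) :
      Ax (iff' (Formula.fsince φ ψ) (or' ψ (and' φ (sprev (Formula.fsince φ ψ)))))
  | japp (t s : JTerm) (i : Fin h) (φ ψ : Formula h) :
      Ax ((Formula.jbox t i (φ.imp ψ)).imp ((Formula.jbox s i φ).imp (Formula.jbox (.app t s) i ψ)))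
  | jsum1 (t s : JTerm) (i : Fin h) (φ : Formula h) :
      Ax ((Formula.jbox t i φ).imp (Formula.jbox (.plus t s) i φ))
  | jsum2 (t s : JTerm) (i : Fin h) (φ : Formula h) :
      Ax ((Formula.jbox s i φ).imp (Formula.jbox (.plus t s) i φ))
  | jrefl (t : JTerm) (i : Fin h) (φ : Formula h) : Ax ((Formula.jbox t i φ).imp φ)
  | jpos (t : JTerm) (i : Fin h) (φ : Formula h) :
      Ax ((Formula.jbox t i φ).imp (Formula.jbox (.bang t) i (Formula.jbox t i φ)))

/-- Formulas of the shape [c_n]_{i_n}⋯[c_1]_{i_1}φ with n ≥ 1 and φ an axiom instance. -/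
inductive CSForm {h : ℕ} : Formula h → Prop
  | base (c : ℕ) (i : Fin h) (φ : Formula h) : Ax φ → CSForm (.jbox (.const c) i φ)
  | step (c : ℕ) (i : Fin h) (φ : Formula h) : CSForm φ → CSForm (.jbox (.const c) i φ)

/-- Downward-closed constant specifications. -/
def IsConstSpec {h : ℕ} (CS : Set (Formula h)) : Prop :=
  (∀ φ ∈ CS, CSForm φ) ∧
  (∀ (c : ℕ) (i : Fin h) (φ : Formula h),
    Formula.jbox (.const c) i φ ∈ CS → CSForm φ → φ ∈ CS)

/-- Derivability in LPLTL^P_CS. -/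
inductive Deriv {h : ℕ} (CS : Set (Formula h)) : Formula h → Prop
  | ax {φ : Formula h} : Ax φ → Deriv CS φ
  | cs {φ : Formula h} : φ ∈ CS → Deriv CS φ
  | mp {φ ψ : Formula h} : Deriv CS (φ.imp ψ) → Deriv CS φ → Deriv CS ψ
  | necNext {φ : Formula h} : Deriv CS φ → Deriv CS (.next φ)
  | necWprev {φ : Formula h} : Deriv CS φ → Deriv CS (.wprev φ)
  | necBox {φ : Formula h} : Deriv CS φ → Deriv CS (always φ)
  | necHbox {φ : Formula h} : Deriv CS φ → Deriv CS (halways φ)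

def conjList {h : ℕ} : List (Formula h) → Formula h
  | [] => top
  | φ :: l => and' φ (conjList l)

def disjList {h : ℕ} : List (Formula h) → Formula h
  | [] => .bot
  | φ :: l => or' φ (disjList l)

/-- Γ ⊢_CS φ : derivability from assumptions. -/
def DerivFrom {h : ℕ} (CS : Set (Formula h)) (Γ : Set (Formula h)) (φ : Formula h) : Prop :=
  ∃ L : List (Formula h), (∀ ψ ∈ L, ψ ∈ Γ) ∧ Deriv CS ((conjList L).imp φ)

/-- CS-consistency. -/
def Consistent {h : ℕ} (CS : Set (Formula h)) (Γ : Set (Formula h)) : Prop :=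
  ¬ DerivFrom CS Γ .bot

/-- Maximal CS-consistent sets. -/
def MaxCons {h : ℕ} (CS : Set (Formula h)) (Γ : Set (Formula h)) : Prop :=
  Consistent CS Γ ∧ ∀ Δ, Γ ⊆ Δ → Consistent CS Δ → Δ = Γ

/-- Subformulas. -/
def Subf {h : ℕ} : Formula h → Set (Formula h)
  | .atom P => {.atom P}
  | .bot => {.bot}
  | .imp φ ψ => insert (.imp φ ψ) (Subf φ ∪ Subf ψ)
  | .next φ => insert (.next φ) (Subf φ)
  | .wprev φ => insert (.wprev φ) (Subf φ)
  | .funtil φ ψ => insert (.funtil φ ψ) (Subf φ ∪ Subf ψ)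
  | .fsince φ ψ => insert (.fsince φ ψ) (Subf φ ∪ Subf ψ)
  | .jbox t i φ => insert (.jbox t i φ) (Subf φ)

/-- A_χ := Sub(χ) ∪ Sub(⊤ S Ⓦ⊥). -/
def Achi {h : ℕ} (χ : Formula h) : Set (Formula h) :=
  Subf χ ∪ Subf (Formula.fsince top (Formula.wprev .bot))

/-- Sub⁺(χ) := A_χ ∪ {¬ψ | ψ ∈ A_χ}. -/
def SubPlus {h : ℕ} (χ : Formula h) : Set (Formula h) :=
  Achi χ ∪ (neg '' Achi χ)

/-- MCS_χ : the χ-maximal CS-consistent subsets of Sub⁺(χ). -/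
def ChiMCS {h : ℕ} (CS : Set (Formula h)) (χ : Formula h) : Set (Set (Formula h)) :=
  {Γb | Γb ⊆ SubPlus χ ∧ Consistent CS Γb ∧
    ∀ Δ, Γb ⊆ Δ → Δ ⊆ SubPlus χ → Consistent CS Δ → Δ = Γb}

/-- The relation R_○ on MCS_χ, via representatives Γ, Δ ∈ MCS:
    Γ̄ R_○ Δ̄ iff {○φ | φ ∈ Δ} ⊆ Γ. -/
def RNext {h : ℕ} (CS : Set (Formula h)) (χ : Formula h) (Γb Δb : Set (Formula h)) : Prop :=
  ∃ Γ Δ : Set (Formula h), MaxCons CS Γ ∧ MaxCons CS Δ ∧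
    Γb = Γ ∩ SubPlus χ ∧ Δb = Δ ∩ SubPlus χ ∧
    ∀ φ ∈ Δ, Formula.next φ ∈ Γ

/-- γ is a conjunction of all elements of the finite set S (in some order). -/
def IsConj {h : ℕ} (S : Set (Formula h)) (γ : Formula h) : Prop :=
  ∃ L : List (Formula h), L.Nodup ∧ (∀ ψ, ψ ∈ L ↔ ψ ∈ S) ∧ γ = conjList L

/-- Acceptable sequences of elements of MCS_χ. -/
def Acceptable {h : ℕ} (CS : Set (Formula h)) (χ : Formula h)
    (f : ℕ → Set (Formula h)) : Prop :=
  (∀ n, f n ∈ ChiMCS CS χ) ∧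
  (∀ n, RNext CS χ (f n) (f (n + 1))) ∧
  (∀ n (φ ψ : Formula h), Formula.funtil φ ψ ∈ f n →
    ∃ m, n ≤ m ∧ ψ ∈ f m ∧ ∀ k, n ≤ k → k < m → φ ∈ f k) ∧
  Formula.wprev .bot ∈ f 0

end TJL

namespace TJL

open Formula

variable {h : ℕ} {CS : Set (Formula h)}

theorem IsPropEval.conjList {v : Formula h → Bool} (hv : IsPropEval v) (L : List (Formula h)) :
    v (conjList L) = L.all v := by
  induction L with
  | nil => simp [TJL.conjList, top, neg, hv.1, hv.2]
  | cons φ L ih => simp [TJL.conjList, and', or', neg, hv.1, hv.2, ih]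

theorem Deriv.of_taut {φ : Formula h} (H : Tautology φ) : Deriv CS φ :=
  .ax (.taut φ H)

namespace DerivFrom

variable {Γ Δ : Set (Formula h)} {φ ψ : Formula h}

theorem mono (H : Γ ⊆ Δ) : DerivFrom CS Γ φ → DerivFrom CS Δ φ
  | ⟨L, hL, hd⟩ => ⟨L, fun ψ hψ => H (hL ψ hψ), hd⟩

theorem of_deriv (H : Deriv CS φ) : DerivFrom CS Γ φ := by
  refine ⟨[], by simp, .mp (.of_taut fun v hv => ?_) H⟩
  simp only [hv.2]
  cases v φ <;> simp

theorem of_mem (H : φ ∈ Γ) : DerivFrom CS Γ φ := by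
  refine ⟨[φ], by simpa using H, .of_taut fun v hv => ?_⟩
  simp only [hv.2, hv.conjList]
  cases hφ : v φ <;> simp [hφ]

theorem mp : DerivFrom CS Γ (φ.imp ψ) → DerivFrom CS Γ φ → DerivFrom CS Γ ψ
  | ⟨L, hL, hd⟩, ⟨M, hM, he⟩ => by
    refine ⟨L ++ M, ?_, .mp (.mp (.of_taut fun v hv => ?_) hd) he⟩
    · intro χ hχ
      exact (List.mem_append.1 hχ).elim (hL χ) (hM χ)
    · simp only [hv.2, hv.conjList, List.all_append]
      cases L.all v <;> cases M.all v <;> cases v φ <;> cases v ψ <;> rfl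

/-- The deduction theorem. -/
theorem imp_of_insert : DerivFrom CS (insert φ Γ) ψ → DerivFrom CS Γ (φ.imp ψ)
  | ⟨L, hL, hd⟩ => by
    classical
    refine ⟨L.filter (· ≠ φ), ?_, .mp (.of_taut fun v hv => ?_) hd⟩
    · intro χ hχ
      obtain ⟨hmem, hne⟩ := List.mem_filter.1 hχ
      exact (hL χ hmem).resolve_left (by simpa using hne)
    · simp only [hv.2, hv.conjList]
      cases hφ : v φ
      · simp
      · have : (L.filter (· ≠ φ)).all v = L.all v := by
          rw [Bool.eq_iff_iff]
          simp only [List.all_eq_true, List.mem_filter, decide_eq_true_eq]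
          refine ⟨fun H χ hχ => ?_, fun H χ hχ => H χ hχ.1⟩
          by_cases hc : χ = φ
          · rwa [hc]
          · exact H χ ⟨hχ, hc⟩
        rw [this]
        cases L.all v <;> cases v ψ <;> rfl

theorem next (H : ∀ ψ ∈ Δ, Formula.next ψ ∈ Γ) :
    DerivFrom CS Δ φ → DerivFrom CS Γ (Formula.next φ) := by
  rintro ⟨L, hL, hd⟩
  induction L generalizing φ with
  | nil =>
    exact of_deriv (.necNext (.mp hd (.of_taut fun v hv => by rw [hv.conjList]; rfl)))
  | cons χ L ih =>
    have hχ : DerivFrom CS Γ (Formula.next (χ.imp φ)) := by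
      refine ih (fun ψ hψ => hL ψ (List.mem_cons_of_mem _ hψ)) (.mp (.of_taut fun v hv => ?_) hd)
      simp only [hv.2, hv.conjList, List.all_cons]
      cases L.all v <;> cases v χ <;> cases v φ <;> rfl
    exact mp (mp (of_deriv (.ax (.nextK χ φ))) hχ) (of_mem (H χ (hL χ List.mem_cons_self)))

end DerivFrom

theorem Deriv.next_neg_imp (φ : Formula h) :
    Deriv CS ((Formula.next (neg φ)).imp (neg (Formula.next φ))) := by
  refine .mp (.of_taut fun v hv => ?_) (.ax (.func φ))
  simp only [iff', and', or', neg, hv.1, hv.2]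
  cases v (Formula.next (φ.imp .bot)) <;> cases v (Formula.next φ) <;> rfl

theorem Deriv.neg_next_imp (φ : Formula h) :
    Deriv CS ((neg (Formula.next φ)).imp (Formula.next (neg φ))) := by
  refine .mp (.of_taut fun v hv => ?_) (.ax (.func φ))
  simp only [iff', and', or', neg, hv.1, hv.2]
  cases v (Formula.next (φ.imp .bot)) <;> cases v (Formula.next φ) <;> rfl

namespace Consistent

variable {Γ Δ : Set (Formula h)} {φ : Formula h}

theorem mono (hΔ : Consistent CS Δ) (H : Γ ⊆ Δ) : Consistent CS Γ :=
  fun hd => hΔ (hd.mono H)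

theorem not_mem_of_neg_mem (hΓ : Consistent CS Γ) (hn : neg φ ∈ Γ) : φ ∉ Γ :=
  fun hp => hΓ (.mp (.of_mem hn) (.of_mem hp))

theorem sUnion {C : Set (Set (Formula h))} (hC : ∀ Γ ∈ C, Consistent CS Γ)
    (hdir : DirectedOn (· ⊆ ·) C) (hne : C.Nonempty) : Consistent CS (⋃₀ C) := by
  rintro ⟨L, hL, hd⟩
  obtain ⟨Γ, hΓ, hsub⟩ := hdir.exists_mem_subset_of_finite_of_subset_sUnion hne
    (List.finite_toSet L) hL
  exact hC Γ hΓ ⟨L, hsub, hd⟩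

/-- Lindenbaum's lemma. -/
theorem exists_maxCons (hΓ : Consistent CS Γ) : ∃ Δ, Γ ⊆ Δ ∧ MaxCons CS Δ := by
  obtain ⟨Δ, hsub, hΔ⟩ := zorn_subset_nonempty {Δ | Consistent CS Δ}
    (fun C hC hchain hne => ⟨⋃₀ C, sUnion hC hchain.directedOn hne,
      fun s hs => Set.subset_sUnion_of_mem hs⟩) Γ hΓ
  exact ⟨Δ, hsub, hΔ.prop, fun E hE hcons => (hΔ.eq_of_subset hcons hE).symm⟩

end Consistent

namespace MaxCons

variable {Γ : Set (Formula h)} {φ : Formula h}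

theorem mem_of_derivFrom (hΓ : MaxCons CS Γ) (hd : DerivFrom CS Γ φ) : φ ∈ Γ := by
  have := hΓ.2 (insert φ Γ) (Set.subset_insert φ Γ)
    fun hbot => hΓ.1 (.mp hbot.imp_of_insert hd)
  exact this ▸ Set.mem_insert φ Γ

theorem neg_mem_of_not_mem (hΓ : MaxCons CS Γ) (hφ : φ ∉ Γ) : neg φ ∈ Γ := by
  by_contra hn
  refine hφ (hΓ.2 (insert φ Γ) (Set.subset_insert φ Γ) (fun hbot => ?_) ▸ Set.mem_insert φ Γ)
  exact hn (hΓ.mem_of_derivFrom hbot.imp_of_insert)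

theorem setOf_next_mem (hΓ : MaxCons CS Γ) : MaxCons CS {φ | Formula.next φ ∈ Γ} := by
  refine ⟨fun hbot => ?_, fun Δ hsub hΔ => (hsub.antisymm fun φ hφ => ?_).symm⟩
  · have htop : Deriv CS (Formula.next (neg .bot)) :=
      .necNext (.of_taut fun v hv => by simp [neg, hv.1, hv.2])
    exact hΓ.1 (.mp (.of_deriv (.mp (Deriv.next_neg_imp _) htop)) (hbot.next fun _ hψ => hψ))
  · by_contra hn
    refine hΔ.not_mem_of_neg_mem (hsub ?_) hφ
    exact hΓ.mem_of_derivFrom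
      (.mp (.of_deriv (Deriv.neg_next_imp φ)) (.of_mem (hΓ.neg_mem_of_not_mem hn)))

theorem inter_subPlus_mem_chiMCS (hΓ : MaxCons CS Γ) (χ : Formula h) :
    Γ ∩ SubPlus χ ∈ ChiMCS CS χ := by
  refine ⟨Set.inter_subset_right, hΓ.1.mono Set.inter_subset_left, fun Δ hsub hχ hΔ =>
    (hsub.antisymm fun φ hφ => ⟨?_, hχ hφ⟩).symm⟩
  by_contra hn
  rcases hχ hφ with hA | ⟨ψ, hψ, rfl⟩
  · exact hΔ.not_mem_of_neg_mem
      (hsub ⟨hΓ.neg_mem_of_not_mem hn, .inr ⟨φ, hA, rfl⟩⟩) hφ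
  · refine hΔ.not_mem_of_neg_mem hφ (hsub ⟨?_, .inl hψ⟩)
    by_contra hc
    exact hn (hΓ.neg_mem_of_not_mem hc)

end MaxCons

theorem exists_maxCons_eq_inter {χ : Formula h} {Γb : Set (Formula h)}
    (hΓb : Γb ∈ ChiMCS CS χ) : ∃ Γ, MaxCons CS Γ ∧ Γb = Γ ∩ SubPlus χ := by
  obtain ⟨hsub, hcons, hmax⟩ := hΓb
  obtain ⟨Γ, hle, hΓ⟩ := hcons.exists_maxCons
  exact ⟨Γ, hΓ, (hmax _ (Set.subset_inter hle hsub) Set.inter_subset_right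
    (hΓ.1.mono Set.inter_subset_left)).symm⟩

end TJL

open TJL TJL.Formula in
/-- The relation R_○ on MCS_χ is serial. -/
theorem rnext_serial (h : ℕ) (hh : 1 ≤ h)
    (CS : Set (Formula h)) (hCS : IsConstSpec CS) (χ : Formula h) :
    ∀ Γb ∈ ChiMCS CS χ, ∃ Δb ∈ ChiMCS CS χ, RNext CS χ Γb Δb := by
  intro Γb hΓb
  obtain ⟨Γ, hΓ, rfl⟩ := exists_maxCons_eq_inter hΓb
  exact ⟨_, hΓ.setOf_next_mem.inter_subPlus_mem_chiMCS χ, Γ, _, hΓ, hΓ.setOf_next_mem,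
    rfl, rfl, fun _ hφ => hφ⟩
end

section
/- Soundness of LPLTL^P with respect to interpreted systems: for each formula φ and each finite set of formulas Γ, if Γ ⊢_CS φ then Γ ⊨_CS φ. -/
namespace TJL

open Formula

/-- Interpreted systems for CS, with states drawn from type `State`. -/
structure IntSystem (State : Type) (h : ℕ) (CS : Set (Formula h)) where
  nonempty : Nonempty State
  Rel : Fin h → State → State → Prop
  refl : ∀ i s, Rel i s s
  trans : ∀ i a b c, Rel i a b → Rel i b c → Rel i a c
  Runs : Set (ℕ → State)
  runsNonempty : Runs.Nonempty
  E : Fin h → State → JTerm → Set (Formula h)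
  mono : ∀ i v w t, Rel i v w → E i v t ⊆ E i w t
  csCond : ∀ i w t φ, Formula.jbox t i φ ∈ CS → φ ∈ E i w t
  appCond : ∀ i w t s φ ψ, φ.imp ψ ∈ E i w t → φ ∈ E i w s → ψ ∈ E i w (.app t s)
  sumCond : ∀ i w t s φ, φ ∈ E i w s ∪ E i w t → φ ∈ E i w (.plus s t)
  bangCond : ∀ i w t φ, φ ∈ E i w t → Formula.jbox t i φ ∈ E i w (.bang t)
  val : State → Set ℕ

/-- Truth of a formula at point (r, n) of an interpreted system. -/
def Sat {State : Type} {h : ℕ} {CS : Set (Formula h)} (I : IntSystem State h CS) :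
    Formula h → (ℕ → State) → ℕ → Prop
  | .atom P, r, n => P ∈ I.val (r n)
  | .bot, _, _ => False
  | .imp φ ψ, r, n => Sat I φ r n → Sat I ψ r n
  | .next φ, r, n => Sat I φ r (n + 1)
  | .wprev φ, r, n => n = 0 ∨ Sat I φ r (n - 1)
  | .funtil φ ψ, r, n => ∃ m, n ≤ m ∧ Sat I ψ r m ∧ ∀ k, n ≤ k → k < m → Sat I φ r k
  | .fsince φ ψ, r, n => ∃ m, m ≤ n ∧ Sat I ψ r m ∧ ∀ k, m < k → k ≤ n → Sat I φ r k
  | .jbox t i φ, r, n =>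
      φ ∈ I.E i (r n) t ∧ ∀ r' ∈ I.Runs, ∀ n' : ℕ, I.Rel i (r n) (r' n') → Sat I φ r' n'

/-- Γ ⊨_CS φ : local semantic consequence over interpreted systems. -/
def SemConseq {h : ℕ} (CS : Set (Formula h)) (Γ : Set (Formula h)) (φ : Formula h) : Prop :=
  ∀ (State : Type) (I : IntSystem State h CS), ∀ r ∈ I.Runs, ∀ n : ℕ,
    (∀ ψ ∈ Γ, Sat I ψ r n) → Sat I φ r n

end TJL

namespace TJL

open Formula

section Soundness

variable {State : Type} {h : ℕ} {CS : Set (Formula h)} (I : IntSystem State h CS)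
  (φ ψ : Formula h) (r : ℕ → State) (n : ℕ)

@[simp] theorem sat_bot : ¬ Sat I .bot r n := id

@[simp] theorem sat_imp : Sat I (φ.imp ψ) r n ↔ (Sat I φ r n → Sat I ψ r n) := Iff.rfl

@[simp] theorem sat_next : Sat I φ.next r n ↔ Sat I φ r (n + 1) := Iff.rfl

@[simp] theorem sat_wprev : Sat I φ.wprev r n ↔ n = 0 ∨ Sat I φ r (n - 1) := Iff.rfl

@[simp] theorem sat_funtil : Sat I (φ.funtil ψ) r n ↔
    ∃ m, n ≤ m ∧ Sat I ψ r m ∧ ∀ k, n ≤ k → k < m → Sat I φ r k := Iff.rfl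

@[simp] theorem sat_fsince : Sat I (φ.fsince ψ) r n ↔
    ∃ m, m ≤ n ∧ Sat I ψ r m ∧ ∀ k, m < k → k ≤ n → Sat I φ r k := Iff.rfl

@[simp] theorem sat_jbox (t : JTerm) (i : Fin h) : Sat I (φ.jbox t i) r n ↔
    φ ∈ I.E i (r n) t ∧
      ∀ r' ∈ I.Runs, ∀ n' : ℕ, I.Rel i (r n) (r' n') → Sat I φ r' n' := Iff.rfl

@[simp] theorem sat_neg : Sat I φ.neg r n ↔ ¬ Sat I φ r n := Iff.rfl

@[simp] theorem sat_top : Sat I top r n := id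

@[simp] theorem sat_or : Sat I (φ.or' ψ) r n ↔ Sat I φ r n ∨ Sat I ψ r n := by
  simp only [or', sat_imp, sat_neg]
  tauto

@[simp] theorem sat_and : Sat I (φ.and' ψ) r n ↔ Sat I φ r n ∧ Sat I ψ r n := by
  simp only [and', sat_or, sat_neg]
  tauto

@[simp] theorem sat_iff : Sat I (φ.iff' ψ) r n ↔ (Sat I φ r n ↔ Sat I ψ r n) := by
  simp only [iff', sat_and, sat_imp]
  tauto

@[simp] theorem sat_sprev : Sat I φ.sprev r n ↔ n ≠ 0 ∧ Sat I φ r (n - 1) := by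
  simp [sprev]

@[simp] theorem sat_ev : Sat I φ.ev r n ↔ ∃ m, n ≤ m ∧ Sat I φ r m := by
  simp [ev]

@[simp] theorem sat_always : Sat I φ.always r n ↔ ∀ m, n ≤ m → Sat I φ r m := by
  simp [always]

@[simp] theorem sat_once : Sat I φ.once r n ↔ ∃ m, m ≤ n ∧ Sat I φ r m := by
  simp [once]

@[simp] theorem sat_halways : Sat I φ.halways r n ↔ ∀ m, m ≤ n → Sat I φ r m := by
  simp [halways]

theorem sat_conjList (L : List (Formula h)) :
    Sat I (conjList L) r n ↔ ∀ ψ ∈ L, Sat I ψ r n := by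
  induction L <;> simp_all [conjList]

variable {φ} in
theorem Tautology.sat (hφ : Tautology φ) : Sat I φ r n := by
  classical
  simpa using hφ (fun ψ => decide (Sat I ψ r n))
    ⟨by simp, fun φ ψ => by by_cases Sat I φ r n <;> simp_all⟩

theorem sat_funtil_unfold : Sat I (φ.funtil ψ) r n ↔
    Sat I ψ r n ∨ Sat I φ r n ∧ Sat I (φ.funtil ψ) r (n + 1) := by
  simp only [sat_funtil]
  constructor
  · rintro ⟨m, hnm, hψ, hφ⟩
    rcases hnm.eq_or_lt with rfl | hlt
    · exact .inl hψ
    · exact .inr ⟨hφ n le_rfl hlt, m, hlt, hψ, fun k hk => hφ k (by omega)⟩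
  · rintro (hψ | ⟨hn, m, hnm, hψ, hφ⟩)
    · exact ⟨n, le_rfl, hψ, fun k _ _ => by omega⟩
    · refine ⟨m, by omega, hψ, fun k hk hkm => ?_⟩
      rcases hk.eq_or_lt with rfl | hlt
      · exact hn
      · exact hφ k hlt hkm

theorem sat_fsince_unfold : Sat I (φ.fsince ψ) r n ↔
    Sat I ψ r n ∨ Sat I φ r n ∧ n ≠ 0 ∧ Sat I (φ.fsince ψ) r (n - 1) := by
  simp only [sat_fsince]
  constructor
  · rintro ⟨m, hmn, hψ, hφ⟩
    rcases hmn.eq_or_lt with rfl | hlt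
    · exact .inl hψ
    · exact .inr ⟨hφ n hlt le_rfl, by omega, m, by omega, hψ,
        fun k hk hkn => hφ k hk (by omega)⟩
  · rintro (hψ | ⟨hn, h0, m, hmn, hψ, hφ⟩)
    · exact ⟨n, le_rfl, hψ, fun k _ _ => by omega⟩
    · refine ⟨m, by omega, hψ, fun k hk hkn => ?_⟩
      rcases hkn.eq_or_lt with rfl | hlt
      · exact hn
      · exact hφ k hk (by omega)

variable {φ r} in
theorem Ax.sat (hφ : Ax φ) (hr : r ∈ I.Runs) : Sat I φ r n := by
  cases hφ with
  | taut _ hτ => exact hτ.sat I r n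
  | nextK φ ψ => exact id
  | boxK φ ψ =>
    simp only [sat_imp, sat_always]
    exact fun himp hφ m hm => himp m hm (hφ m hm)
  | func φ => simp
  | ind φ =>
    simp only [sat_imp, sat_always, sat_next]
    exact fun hstep hφ m hm => Nat.le_induction hφ hstep m hm
  | until1 φ ψ =>
    simp only [sat_imp, sat_ev, sat_funtil]
    exact fun ⟨m, hnm, hψ, _⟩ => ⟨m, hnm, hψ⟩
  | until2 φ ψ =>
    rw [sat_iff, sat_or, sat_and, sat_next]
    exact sat_funtil_unfold I φ ψ r n
  | hboxK φ ψ =>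
    simp only [sat_imp, sat_halways]
    exact fun himp hφ m hm => himp m hm (hφ m hm)
  | wprevK φ ψ =>
    simp only [sat_imp, sat_wprev]
    tauto
  | sw φ =>
    simp only [sat_imp, sat_sprev, sat_wprev]
    exact fun ⟨_, hφ⟩ => .inr hφ
  | fp φ => simp
  | pf φ =>
    cases n <;> simp
  | initial => exact (sat_once ..).2 ⟨0, n.zero_le, .inl rfl⟩
  | hind φ =>
    simp only [sat_imp, sat_halways, sat_wprev]
    intro hstep hφ m hm
    induction hm using Nat.decreasingInduction with
    | self => exact hφ
    | of_succ k hk ih => simpa using hstep (k + 1) hk ih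
  | since1 φ ψ =>
    simp only [sat_imp, sat_once, sat_fsince]
    exact fun ⟨m, hmn, hψ, _⟩ => ⟨m, hmn, hψ⟩
  | since2 φ ψ =>
    rw [sat_iff, sat_or, sat_and, sat_sprev]
    exact sat_fsince_unfold I φ ψ r n
  | japp t s i φ ψ =>
    exact fun ⟨het, ht⟩ ⟨hes, hs⟩ =>
      ⟨I.appCond i _ t s φ ψ het hes, fun r' hr' n' hR => ht r' hr' n' hR (hs r' hr' n' hR)⟩
  | jsum1 t s i φ => exact fun ⟨he, ht⟩ => ⟨I.sumCond i _ s t φ (.inl he), ht⟩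
  | jsum2 t s i φ => exact fun ⟨he, hs⟩ => ⟨I.sumCond i _ s t φ (.inr he), hs⟩
  | jrefl t i φ => exact fun ⟨_, ht⟩ => ht r hr n (I.refl i _)
  | jpos t i φ =>
    exact fun ⟨he, ht⟩ => ⟨I.bangCond i _ t φ he, fun r' _ n' hR =>
      ⟨I.mono i _ _ t hR he, fun r'' hr'' n'' hR' =>
        ht r'' hr'' n'' (I.trans i _ _ _ hR hR')⟩⟩

variable {φ r} in
theorem CSForm.sat (hφ : CSForm φ) (hCS : IsConstSpec CS) (hmem : φ ∈ CS) (hr : r ∈ I.Runs) :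
    Sat I φ r n := by
  induction hφ generalizing r n with
  | base c i φ hax =>
    exact ⟨I.csCond i _ _ φ hmem, fun r' hr' n' _ => hax.sat I n' hr'⟩
  | step c i φ hφ ih =>
    exact ⟨I.csCond i _ _ φ hmem, fun r' hr' n' _ => ih n' (hCS.2 c i φ hmem hφ) hr'⟩

variable {φ r} in
theorem Deriv.sat (hd : Deriv CS φ) (hCS : IsConstSpec CS) (hr : r ∈ I.Runs) :
    Sat I φ r n := by
  induction hd generalizing n with
  | ax hax => exact hax.sat I n hr
  | cs hmem => exact (hCS.1 _ hmem).sat I n hCS hmem hr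
  | mp _ _ himp hφ => exact himp n (hφ n)
  | necNext _ ih => exact ih (n + 1)
  | necWprev _ ih => exact .inr (ih (n - 1))
  | necBox _ ih => exact (sat_always ..).2 fun m _ => ih m
  | necHbox _ ih => exact (sat_halways ..).2 fun m _ => ih m

end Soundness

end TJL

open TJL TJL.Formula in
/-- Soundness of LPLTL^P_CS with respect to interpreted systems:
    Γ ⊢_CS φ implies Γ ⊨_CS φ, for finite Γ. -/
theorem lpltlp_soundness (h : ℕ) (hh : 1 ≤ h)
    (CS : Set (Formula h)) (hCS : IsConstSpec CS)
    (Γ : Set (Formula h)) (hfin : Γ.Finite) (φ : Formula h)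
    (hd : DerivFrom CS Γ φ) :
    SemConseq CS Γ φ := by
  obtain ⟨L, hL, hd⟩ := hd
  exact fun State I r hr n hΓ =>
    hd.sat I n hCS hr ((sat_conjList I r n L).2 fun ψ hψ => hΓ ψ (hL ψ hψ))
end
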